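/- There exist constants c, C > 0 such that for all n, k ∈ ℕ with n ≥ 2 and k ≤ n^{1/4}, and all z ∈ ℤ² with ‖z‖ ≥ 5√n, the simple random walk on ℤ² started at the origin satisfies P[ R(n) ∩ Q(z,k) ≠ ∅ ] ≤ (C / log n) · exp( −c ‖z‖² / n ). -/

import Mathlib

open Real

/-- A single step of the simple random walk on `ℤ^d`: the pair `(i, b)` encodes a move by
`+eᵢ` (if `b = true`) or `-eᵢ` (if `b = false`).  The uniform distribution on `Fin d × Bool`
corresponds to the uniform distribution on the `2d` unit vectors. -/
def step {d : ℕ} (a : Fin d × Bool) : Fin d → ℤ :=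
  fun j => if j = a.1 then (if a.2 then 1 else -1) else 0

/-- The position `S(k)` of the walk started at `z` after `k` steps, driven by the
sequence of i.i.d. uniform steps `ω : Fin n → Fin d × Bool` (meaningful for `k ≤ n`). -/
def walk {d n : ℕ} (z : Fin d → ℤ) (ω : Fin n → Fin d × Bool) (k : ℕ) : Fin d → ℤ :=
  z + ∑ i ∈ Finset.univ.filter (fun i : Fin n => (i : ℕ) < k), step (ω i)

/-- Probability of an event for the `n`-step simple random walk on `ℤ^d`:
the driving step sequences are uniform among the `(2d)^n` possibilities. -/
noncomputable def prW (d n : ℕ) (E : Set (Fin n → Fin d × Bool)) : ℝ :=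
  E.ncard / (2 * d) ^ n

/-- Expectation of a random variable of the `n`-step simple random walk on `ℤ^d`. -/
noncomputable def exW (d n : ℕ) (f : (Fin n → Fin d × Bool) → ℝ) : ℝ :=
  (∑ ω : Fin n → Fin d × Bool, f ω) / (2 * d) ^ n

/-- Shannon entropy (base 2) of a random variable `X` of the `n`-step walk:
`H(X) = ∑ₐ -P[X = a] · log₂ P[X = a]`. -/
noncomputable def entW {α : Type*} (d n : ℕ) (X : (Fin n → Fin d × Bool) → α) : ℝ :=
  ∑' a : α, -(prW d n {ω | X ω = a} * logb 2 (prW d n {ω | X ω = a}))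

/-- The range `R(n) = {S(0), …, S(n)}` of the `n`-step walk started at `z`. -/
def rangeW {d n : ℕ} (z : Fin d → ℤ) (ω : Fin n → Fin d × Bool) : Finset (Fin d → ℤ) :=
  (Finset.range (n + 1)).image (walk z ω)

/-- The inner boundary `∂A` of a finite set `A ⊆ ℤ^d`: the points of `A` adjacent
(at graph distance 1, i.e. reachable by a single step) to some vertex of the complement. -/
def innerBdry {d : ℕ} (A : Finset (Fin d → ℤ)) : Finset (Fin d → ℤ) :=
  A.filter fun x => ∃ a : Fin d × Bool, x + step a ∉ A

/-- The Euclidean (`L²`) norm on `ℤ^d`. -/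
noncomputable def eNorm {d : ℕ} (x : Fin d → ℤ) : ℝ :=
  Real.sqrt (∑ i, ((x i : ℝ)) ^ 2)

/-- The square `Q(z,k) = {z + (j,j′) : −k ≤ j, j′ ≤ k}` of side length `2k+1` centered at `z`. -/
def square (z : Fin 2 → ℤ) (k : ℕ) : Set (Fin 2 → ℤ) :=
  {w | ∀ i, |w i - z i| ≤ (k : ℤ)}

/-- The `t`-step transition probability of the simple random walk on `ℤ` from `0` to `a`. -/
noncomputable def lineKernel : ℕ → ℤ → ℝ
  | 0, a => if a = 0 then 1 else 0
  | t + 1, a => (lineKernel t (a - 1) + lineKernel t (a + 1)) / 2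

lemma lineKernel_nonneg (t : ℕ) (a : ℤ) : 0 ≤ lineKernel t a := by
  induction t generalizing a with
  | zero => unfold lineKernel; split_ifs <;> norm_num
  | succ t ih => unfold lineKernel; linarith [ih (a - 1), ih (a + 1)]

lemma lineKernel_neg (t : ℕ) (a : ℤ) : lineKernel t (-a) = lineKernel t a := by
  induction t generalizing a with
  | zero => simp [lineKernel]
  | succ t ih =>
    unfold lineKernel
    rw [← ih (a - 1), ← ih (a + 1), add_comm]
    congr 3 <;> ring

lemma lineKernel_eq_zero_of_lt (t : ℕ) (a : ℤ) (h : a < -t) : lineKernel t a = 0 := by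
  induction t generalizing a with
  | zero => unfold lineKernel; rw [if_neg]; push_cast at h; omega
  | succ t ih =>
    unfold lineKernel
    push_cast at h
    rw [ih _ (by omega), ih _ (by omega)]; simp

lemma lineKernel_eq_zero_of_odd (t : ℕ) (a : ℤ) (h : Odd (t + a)) : lineKernel t a = 0 := by
  induction t generalizing a with
  | zero =>
    unfold lineKernel
    rw [if_neg]
    rintro rfl
    simp at h
  | succ t ih =>
    unfold lineKernel
    obtain ⟨r, hr⟩ := h
    push_cast at hr
    rw [ih (a - 1) ⟨r - 1, by omega⟩, ih (a + 1) ⟨r, by omega⟩]; simp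

lemma lineKernel_eq_choose (t j : ℕ) : lineKernel t (2 * j - t) = t.choose j / 2 ^ t := by
  induction t generalizing j with
  | zero => cases j <;> simp [lineKernel]; omega
  | succ t ih =>
    unfold lineKernel
    cases j with
    | zero =>
      rw [lineKernel_eq_zero_of_lt _ _ (by push_cast; omega)]
      have := ih 0
      rw [show (2 * ((0 : ℕ) : ℤ) - ((t + 1 : ℕ) : ℤ) + 1) = 2 * ((0 : ℕ) : ℤ) - t by
        push_cast; ring, this]
      simp [pow_succ]
      ring
    | succ j =>
      rw [show (2 * ((j + 1 : ℕ) : ℤ) - ((t + 1 : ℕ) : ℤ) + 1) = 2 * ((j + 1 : ℕ) : ℤ) - t by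
          push_cast; ring,
        show (2 * ((j + 1 : ℕ) : ℤ) - ((t + 1 : ℕ) : ℤ) - 1) = 2 * (j : ℤ) - t by
          push_cast; ring, ih, ih, Nat.choose_succ_succ]
      push_cast
      field_simp
      ring

lemma lineKernel_even_eq (m b : ℕ) :
    lineKernel (2 * m) (2 * b) = (2 * m).choose (m + b) / 4 ^ m := by
  have := lineKernel_eq_choose (2 * m) (m + b)
  rw [show (2 * ((m + b : ℕ) : ℤ) - ((2 * m : ℕ) : ℤ)) = 2 * b by push_cast; ring] at this
  rw [this, pow_mul]; norm_num

lemma centralBinom_succ_real (m : ℕ) :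
    ((m + 1).centralBinom : ℝ) = 2 * (2 * m + 1) / (m + 1) * m.centralBinom := by
  have := Nat.succ_mul_centralBinom_succ m
  have h : ((m : ℝ) + 1) * (m + 1).centralBinom = 2 * (2 * m + 1) * m.centralBinom := by
    exact_mod_cast this
  field_simp
  linarith

lemma sq_centralBinom_le (m : ℕ) : (m.centralBinom : ℝ) ^ 2 * (2 * m + 1) ≤ (4 ^ m) ^ 2 := by
  induction m with
  | zero => simp
  | succ m ih =>
    rw [centralBinom_succ_real]
    push_cast
    calc (2 * (2 * (m : ℝ) + 1) / (m + 1) * m.centralBinom) ^ 2 * (2 * (m + 1) + 1)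
        = (m.centralBinom : ℝ) ^ 2 * (2 * m + 1) *
            (4 * ((2 * m + 1) * (2 * m + 3)) / (m + 1) ^ 2) := by
          field_simp; ring
      _ ≤ (4 ^ m) ^ 2 * 16 := by
          gcongr
          rw [div_le_iff₀ (by positivity)]
          nlinarith
      _ = _ := by ring

lemma le_sq_centralBinom (m : ℕ) (hm : 1 ≤ m) :
    (4 ^ m) ^ 2 ≤ (m.centralBinom : ℝ) ^ 2 * (4 * m) := by
  induction m, hm using Nat.le_induction with
  | base => simp [Nat.centralBinom]; norm_num
  | succ m hm ih =>
    rw [centralBinom_succ_real]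
    push_cast
    have hm' : (1 : ℝ) ≤ m := by exact_mod_cast hm
    calc ((4 : ℝ) ^ (m + 1)) ^ 2 = (4 ^ m) ^ 2 * 16 := by ring
      _ ≤ (m.centralBinom : ℝ) ^ 2 * (4 * m) * (4 * (2 * m + 1) ^ 2 / (m * (m + 1))) := by
          gcongr
          rw [le_div_iff₀ (by positivity)]
          nlinarith
      _ = _ := by field_simp; ring

lemma choose_add_succ_real (m b : ℕ) (hb : b ≤ m) :
    ((2 * m).choose (m + (b + 1)) : ℝ) =
      (2 * m).choose (m + b) * (1 - (2 * b + 1) / (m + b + 1)) := by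
  have := Nat.choose_succ_right_eq (2 * m) (m + b)
  rw [show 2 * m - (m + b) = m - b by omega] at this
  have h : ((2 * m).choose (m + (b + 1)) : ℝ) * (m + b + 1) =
      (2 * m).choose (m + b) * (m - b) := by
    rw [← Nat.cast_sub hb]
    exact_mod_cast this
  have hpos : (0 : ℝ) < m + b + 1 := by positivity
  rw [one_sub_div hpos.ne', mul_div_assoc', eq_div_iff hpos.ne', h]
  ring

lemma choose_le_centralBinom_mul_exp (m b : ℕ) :
    ((2 * m).choose (m + b) : ℝ) ≤ m.centralBinom * exp (-(b : ℝ) ^ 2 / (2 * m + 1)) := by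
  induction b with
  | zero => simp [Nat.centralBinom]
  | succ b ih =>
    rcases lt_or_ge b m with h | h
    · rw [choose_add_succ_real m b h.le]
      have hb : (b : ℝ) ≤ m := by exact_mod_cast h.le
      have h1 : 1 - (2 * (b : ℝ) + 1) / (m + b + 1) ≤ exp (-((2 * b + 1) / (2 * m + 1))) := by
        have h2 := add_one_le_exp (-((2 * (b : ℝ) + 1) / (2 * m + 1)))
        have h3 : (2 * (b : ℝ) + 1) / (2 * m + 1) ≤ (2 * b + 1) / (m + b + 1) := by
          gcongr
          linarith
        linarith
      calc ((2 * m).choose (m + b) : ℝ) * (1 - (2 * b + 1) / (m + b + 1))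
          ≤ (2 * m).choose (m + b) * exp (-((2 * b + 1) / (2 * m + 1))) := by gcongr
        _ ≤ m.centralBinom * exp (-(b : ℝ) ^ 2 / (2 * m + 1)) *
              exp (-((2 * b + 1) / (2 * m + 1))) := by gcongr
        _ = _ := by
          rw [mul_assoc, ← exp_add]
          congr 2
          push_cast
          field_simp
          ring
    · rw [Nat.choose_eq_zero_of_lt (by omega)]
      simp only [Nat.cast_zero]
      positivity

lemma centralBinom_mul_le_choose (m b : ℕ) :
    (m.centralBinom : ℝ) * (1 - (b : ℝ) ^ 2 / (m + 1)) ≤ (2 * m).choose (m + b) := by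
  induction b with
  | zero => simp [Nat.centralBinom]
  | succ b ih =>
    have hM : (0 : ℝ) < m + 1 := by positivity
    rcases le_or_gt ((m : ℝ) + 1) (((b + 1 : ℕ) : ℝ) ^ 2) with h | h
    · have : 1 - ((b + 1 : ℕ) : ℝ) ^ 2 / (m + 1) ≤ 0 := by
        rw [sub_nonpos, le_div_iff₀ hM]; linarith
      exact (mul_nonpos_of_nonneg_of_nonpos (by positivity) this).trans (by positivity)
    · have hbm : b ≤ m := by
        have : (b + 1) ^ 2 < m + 1 := by exact_mod_cast h
        nlinarith
      rw [choose_add_succ_real m b hbm]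
      push_cast at h ⊢
      have h1 : (2 * (b : ℝ) + 1) / (m + b + 1) ≤ (2 * b + 1) / (m + 1) := by
        gcongr
        linarith [(Nat.cast_nonneg b : (0 : ℝ) ≤ b)]
      have h2 : 0 ≤ 1 - (2 * (b : ℝ) + 1) / (m + 1) := by
        rw [sub_nonneg, div_le_one hM]; nlinarith
      calc (m.centralBinom : ℝ) * (1 - (b + 1 : ℝ) ^ 2 / (m + 1))
          ≤ m.centralBinom * ((1 - (b : ℝ) ^ 2 / (m + 1)) * (1 - (2 * b + 1) / (m + 1))) := by
            gcongr
            have : 0 ≤ (b : ℝ) ^ 2 / (m + 1) * ((2 * b + 1) / (m + 1)) := by positivity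
            have e : ((b : ℝ) + 1) ^ 2 / (m + 1) =
                (b : ℝ) ^ 2 / (m + 1) + (2 * b + 1) / (m + 1) := by ring
            rw [e]
            nlinarith
        _ = m.centralBinom * (1 - (b : ℝ) ^ 2 / (m + 1)) * (1 - (2 * b + 1) / (m + 1)) := by ring
        _ ≤ (2 * m).choose (m + b) * (1 - (2 * b + 1) / (m + 1)) := by gcongr
        _ ≤ _ := by gcongr

lemma lineKernel_even_le (m : ℕ) (b : ℤ) :
    lineKernel (2 * m) (2 * b) ≤ exp (-(b : ℝ) ^ 2 / (2 * m + 1)) / √(2 * m + 1) := by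
  wlog hb : 0 ≤ b generalizing b
  · have := this (-b) (by omega)
    rwa [mul_neg, lineKernel_neg, Int.cast_neg, neg_sq] at this
  lift b to ℕ using hb
  have hs : (0 : ℝ) < √(2 * m + 1) := by positivity
  have hc : (m.centralBinom : ℝ) * √(2 * m + 1) ≤ 4 ^ m := by
    apply le_of_sq_le_sq _ (by positivity)
    rw [mul_pow, sq_sqrt (by positivity)]
    exact sq_centralBinom_le m
  rw [lineKernel_even_eq, div_le_div_iff₀ (by positivity) hs]
  calc ((2 * m).choose (m + b) : ℝ) * √(2 * m + 1)
      ≤ m.centralBinom * exp (-(b : ℝ) ^ 2 / (2 * m + 1)) * √(2 * m + 1) := by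
        gcongr
        exact choose_le_centralBinom_mul_exp m b
    _ = exp (-(b : ℝ) ^ 2 / (2 * m + 1)) * (m.centralBinom * √(2 * m + 1)) := by ring
    _ ≤ _ := by
        simp only [Int.cast_natCast]
        gcongr

lemma le_lineKernel_even (m : ℕ) (hm : 1 ≤ m) (b : ℤ) (hb : 2 * b ^ 2 ≤ m) :
    1 / (4 * √m) ≤ lineKernel (2 * m) (2 * b) := by
  wlog hb' : 0 ≤ b generalizing b
  · have := this (-b) (by simpa using hb) (by omega)
    rwa [mul_neg, lineKernel_neg] at this
  lift b to ℕ using hb'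
  have hm' : (1 : ℝ) ≤ m := by exact_mod_cast hm
  have hc : (4 : ℝ) ^ m ≤ m.centralBinom * (2 * √m) := by
    apply le_of_sq_le_sq _ (by positivity)
    rw [mul_pow, mul_pow, sq_sqrt (by positivity)]
    linarith [le_sq_centralBinom m hm]
  have hb2 : 2 * (b : ℝ) ^ 2 ≤ m := by exact_mod_cast hb
  have hhalf : (1 : ℝ) / 2 ≤ 1 - (b : ℝ) ^ 2 / (m + 1) := by
    have : (b : ℝ) ^ 2 / (m + 1) ≤ 1 / 2 := by
      rw [div_le_iff₀ (by positivity)]; linarith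
    linarith
  have h1 := centralBinom_mul_le_choose m b
  have h2 : (m.centralBinom : ℝ) * (1 / 2) ≤ (2 * m).choose (m + b) :=
    le_trans (by gcongr) h1
  rw [lineKernel_even_eq, div_le_div_iff₀ (by positivity) (by positivity), one_mul]
  calc (4 : ℝ) ^ m ≤ m.centralBinom * (2 * √m) := hc
    _ = m.centralBinom * (1 / 2) * (4 * √m) := by ring
    _ ≤ _ := by gcongr

/-- The `t`-step transition probability of the simple random walk on `ℤ²` from `0` to `x`:
the rotated coordinates `x₀ + x₁` and `x₀ - x₁` perform independent walks on `ℤ`. -/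
noncomputable def planeKernel (t : ℕ) (x : Fin 2 → ℤ) : ℝ :=
  lineKernel t (x 0 + x 1) * lineKernel t (x 0 - x 1)

lemma planeKernel_nonneg (t : ℕ) (x : Fin 2 → ℤ) : 0 ≤ planeKernel t x :=
  mul_nonneg (lineKernel_nonneg _ _) (lineKernel_nonneg _ _)

lemma planeKernel_succ (t : ℕ) (x : Fin 2 → ℤ) :
    planeKernel (t + 1) x = (∑ a : Fin 2 × Bool, planeKernel t (x - step a)) / 4 := by
  rw [Fintype.sum_prod_type]
  simp only [Fin.sum_univ_two, Fintype.sum_bool, planeKernel, step, Pi.sub_apply, lineKernel]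
  simp only [if_true, if_false, Fin.isValue, zero_ne_one, one_ne_zero, Bool.false_eq_true]
  rw [show x 0 - 1 + (x 1 - 0) = x 0 + x 1 - 1 by ring,
    show x 0 - 1 - (x 1 - 0) = x 0 - x 1 - 1 by ring,
    show x 0 - -1 + (x 1 - 0) = x 0 + x 1 + 1 by ring,
    show x 0 - -1 - (x 1 - 0) = x 0 - x 1 + 1 by ring,
    show x 0 - 0 + (x 1 - 1) = x 0 + x 1 - 1 by ring,
    show x 0 - 0 - (x 1 - 1) = x 0 - x 1 + 1 by ring,
    show x 0 - 0 + (x 1 - -1) = x 0 + x 1 + 1 by ring,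
    show x 0 - 0 - (x 1 - -1) = x 0 - x 1 - 1 by ring]
  ring

lemma planeKernel_even_le (m : ℕ) (x : Fin 2 → ℤ) :
    planeKernel (2 * m) x ≤
      exp (-((x 0 : ℝ) ^ 2 + (x 1 : ℝ) ^ 2) / (2 * (2 * m + 1))) / (2 * m + 1) := by
  rcases Int.even_or_odd (x 0 + x 1) with h | h
  · obtain ⟨u, hu⟩ := h
    obtain ⟨v, hv⟩ : ∃ v, x 0 - x 1 = 2 * v := ⟨u - x 1, by omega⟩
    have hu' : (x 0 : ℝ) + x 1 = 2 * u := by rw [two_mul]; exact_mod_cast hu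
    have hv' : (x 0 : ℝ) - x 1 = 2 * v := by exact_mod_cast hv
    have hx0 : (x 0 : ℝ) = u + v := by linarith
    have hx1 : (x 1 : ℝ) = u - v := by linarith
    have hsq : √(2 * (m : ℝ) + 1) * √(2 * m + 1) = 2 * m + 1 := mul_self_sqrt (by positivity)
    unfold planeKernel
    rw [hu, hv, ← two_mul]
    calc _ ≤ exp (-(u : ℝ) ^ 2 / (2 * m + 1)) / √(2 * m + 1) *
          (exp (-(v : ℝ) ^ 2 / (2 * m + 1)) / √(2 * m + 1)) :=
        mul_le_mul (lineKernel_even_le m u) (lineKernel_even_le m v) (lineKernel_nonneg _ _)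
          (by positivity)
      _ = _ := by
        rw [div_mul_div_comm, hsq, ← exp_add, hx0, hx1]
        congr 2
        field_simp
        ring
  · unfold planeKernel
    rw [lineKernel_eq_zero_of_odd _ _ (by
      obtain ⟨r, hr⟩ := h
      exact ⟨m + r, by push_cast; omega⟩), zero_mul]
    positivity

lemma half_sq_le_sq_sub_step (x : Fin 2 → ℤ) (hx : 50 ≤ (x 0 : ℝ) ^ 2 + (x 1 : ℝ) ^ 2)
    (a : Fin 2 × Bool) :
    ((x 0 : ℝ) ^ 2 + (x 1 : ℝ) ^ 2) / 2 ≤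
      (((x - step a) 0 : ℤ) : ℝ) ^ 2 + (((x - step a) 1 : ℤ) : ℝ) ^ 2 := by
  obtain ⟨i, s⟩ := a
  fin_cases i <;> cases s <;> simp [step] <;>
    nlinarith [sq_nonneg ((x 0 : ℝ) + 4), sq_nonneg ((x 0 : ℝ) - 4), sq_nonneg ((x 1 : ℝ) + 4),
      sq_nonneg ((x 1 : ℝ) - 4), sq_nonneg (x 0 : ℝ), sq_nonneg (x 1 : ℝ)]

lemma planeKernel_odd_le (m : ℕ) (x : Fin 2 → ℤ) (hx : 50 ≤ (x 0 : ℝ) ^ 2 + (x 1 : ℝ) ^ 2) :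
    planeKernel (2 * m + 1) x ≤
      exp (-((x 0 : ℝ) ^ 2 + (x 1 : ℝ) ^ 2) / (4 * (2 * m + 1))) / (2 * m + 1) := by
  rw [planeKernel_succ, div_le_iff₀ (by norm_num)]
  have key : ∀ a ∈ (Finset.univ : Finset (Fin 2 × Bool)), planeKernel (2 * m) (x - step a) ≤
      exp (-((x 0 : ℝ) ^ 2 + (x 1 : ℝ) ^ 2) / (4 * (2 * m + 1))) / (2 * m + 1) := by
    intro a _
    refine (planeKernel_even_le m _).trans ?_
    gcongr ?_ / _
    rw [exp_le_exp, div_le_div_iff₀ (by positivity) (by positivity)]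
    have := half_sq_le_sq_sub_step x hx a
    have hm : (0 : ℝ) ≤ 2 * (2 * m + 1) := by positivity
    nlinarith
  refine (Finset.sum_le_card_nsmul _ _ _ key).trans (le_of_eq ?_)
  simp
  ring

lemma le_planeKernel_even (m k : ℕ) (hm : 1 ≤ m) (hk : 2 * k ^ 2 ≤ m) (x : Fin 2 → ℤ)
    (hx : Even (x 0 + x 1)) (h1 : |x 0 + x 1| ≤ 2 * k + 1) (h2 : |x 0 - x 1| ≤ 2 * k + 1) :
    1 / (16 * (m : ℝ)) ≤ planeKernel (2 * m) x := by
  obtain ⟨u, hu⟩ := hx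
  obtain ⟨v, hv⟩ : ∃ v, x 0 - x 1 = 2 * v := ⟨u - x 1, by omega⟩
  rw [abs_le] at h1 h2
  have bound : ∀ w : ℤ, |w| ≤ k → 2 * w ^ 2 ≤ m := by
    intro w hw
    have h3 : w ^ 2 ≤ (k : ℤ) ^ 2 := sq_le_sq' (abs_le.1 hw).1 (abs_le.1 hw).2
    have h4 : 2 * (k : ℤ) ^ 2 ≤ m := by exact_mod_cast hk
    linarith
  have hu2 := le_lineKernel_even m hm u (bound u (abs_le.2 ⟨by omega, by omega⟩))
  have hv2 := le_lineKernel_even m hm v (bound v (abs_le.2 ⟨by omega, by omega⟩))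
  unfold planeKernel
  rw [hu, hv, ← two_mul]
  calc 1 / (16 * (m : ℝ)) = 1 / (4 * √m) * (1 / (4 * √m)) := by
        have hsq : √(m : ℝ) * √m = m := mul_self_sqrt (by positivity)
        rw [div_mul_div_comm, one_mul]
        congr 1
        linear_combination -16 * hsq
    _ ≤ _ := mul_le_mul hu2 hv2 (by positivity) (lineKernel_nonneg _ _)

lemma le_planeKernel_add (m k : ℕ) (hm : 1 ≤ m) (hk : 2 * k ^ 2 ≤ m) (x : Fin 2 → ℤ)
    (h0 : |x 0| ≤ k) (h1 : |x 1| ≤ k) :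
    1 / (16 * (m : ℝ)) ≤ planeKernel (2 * m) x + planeKernel (2 * m + 1) x := by
  rw [abs_le] at h0 h1
  rcases Int.even_or_odd (x 0 + x 1) with h | h
  · have := le_planeKernel_even m k hm hk x h (abs_le.2 ⟨by omega, by omega⟩)
      (abs_le.2 ⟨by omega, by omega⟩)
    linarith [planeKernel_nonneg (2 * m + 1) x]
  · have key : ∀ a ∈ (Finset.univ : Finset (Fin 2 × Bool)),
        1 / (16 * (m : ℝ)) ≤ planeKernel (2 * m) (x - step a) := by
      rintro ⟨i, s⟩ -
      obtain ⟨r, hr⟩ := h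
      apply le_planeKernel_even m k hm hk
      · rw [Int.even_iff]
        fin_cases i <;> cases s <;> simp [step] <;> omega
      · rw [abs_le]
        fin_cases i <;> cases s <;> simp [step] <;> omega
      · rw [abs_le]
        fin_cases i <;> cases s <;> simp [step] <;> omega
    have := Finset.card_nsmul_le_sum _ _ _ key
    rw [planeKernel_succ]
    simp only [Finset.card_univ, Fintype.card_prod, Fintype.card_fin, Fintype.card_bool,
      nsmul_eq_mul] at this
    push_cast at this
    linarith [planeKernel_nonneg (2 * m) x]

lemma walk_zero {d n : ℕ} (x : Fin d → ℤ) (ω : Fin n → Fin d × Bool) : walk x ω 0 = x := by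
  simp [walk]

lemma walk_cons_succ {d n : ℕ} (x : Fin d → ℤ) (a : Fin d × Bool) (ω : Fin n → Fin d × Bool)
    (k : ℕ) : walk x (Fin.cons a ω : Fin (n + 1) → Fin d × Bool) (k + 1) =
      walk (x + step a) ω k := by
  simp [walk, Finset.sum_filter, Fin.sum_univ_succ, add_assoc]

lemma prW_le_one (d n : ℕ) (E : Set (Fin n → Fin d × Bool)) : prW d n E ≤ 1 := by
  unfold prW
  apply div_le_one_of_le₀ _ (by positivity)
  have h := Set.ncard_le_ncard (Set.subset_univ E)
  rw [Set.ncard_univ, Nat.card_eq_fintype_card] at h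
  simp only [Fintype.card_pi, Fintype.card_prod, Fintype.card_fin, Fintype.card_bool,
    Finset.prod_const, Finset.card_univ] at h
  rw [mul_comm]
  exact_mod_cast h

/-- Space-time superharmonic functions which are at least `1` on a set dominate the
probability that the walk hits this set. -/
lemma prW_hit_le_of_superharmonic {d : ℕ} (Q : Set (Fin d → ℤ)) (f : ℕ → (Fin d → ℤ) → ℝ)
    (hf : ∀ n x, 0 ≤ f n x) (hQ : ∀ n, ∀ x ∈ Q, 1 ≤ f n x)
    (hs : ∀ n x, (∑ a : Fin d × Bool, f n (x + step a)) / (2 * d) ≤ f (n + 1) x)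
    (n : ℕ) (x : Fin d → ℤ) :
    prW d n {ω | ∃ y ∈ rangeW x ω, y ∈ Q} ≤ f n x := by
  induction n generalizing x with
  | zero =>
    by_cases hx : x ∈ Q
    · exact (prW_le_one _ _ _).trans (hQ _ x hx)
    · have : {ω : Fin 0 → Fin d × Bool | ∃ y ∈ rangeW x ω, y ∈ Q} = ∅ := by
        ext ω
        simp [rangeW, walk_zero, hx]
      rw [this]
      simpa [prW] using hf 0 x
  | succ n ih =>
    by_cases hx : x ∈ Q
    · exact (prW_le_one _ _ _).trans (hQ _ x hx)
    · refine le_trans ?_ (hs n x)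
      have hsub : {ω : Fin (n + 1) → Fin d × Bool | ∃ y ∈ rangeW x ω, y ∈ Q} ⊆
          ⋃ a : Fin d × Bool, (fun ω : Fin n → Fin d × Bool =>
            (Fin.cons a ω : Fin (n + 1) → Fin d × Bool)) ''
              {ω | ∃ y ∈ rangeW (x + step a) ω, y ∈ Q} := by
        intro ω hω
        simp only [Set.mem_iUnion]
        refine ⟨ω 0, Fin.tail ω, ?_, Fin.cons_self_tail ω⟩
        simp only [rangeW, Set.mem_ofPred_eq, Finset.mem_image, Finset.mem_range] at hω ⊢
        obtain ⟨y, ⟨k, hk, rfl⟩, hy⟩ := hω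
        cases k with
        | zero => rw [walk_zero] at hy; exact absurd hy hx
        | succ k =>
          refine ⟨_, ⟨k, by omega, rfl⟩, ?_⟩
          rwa [← walk_cons_succ, Fin.cons_self_tail]
      have hcard : ({ω : Fin (n + 1) → Fin d × Bool | ∃ y ∈ rangeW x ω, y ∈ Q}.ncard : ℝ) ≤
          ∑ a : Fin d × Bool,
            ({ω : Fin n → Fin d × Bool | ∃ y ∈ rangeW (x + step a) ω, y ∈ Q}.ncard : ℝ) := by
        rw [← Nat.cast_sum, Nat.cast_le]
        refine (Set.ncard_le_ncard hsub).trans ((Set.ncard_iUnion_le_of_fintype _).trans ?_)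
        exact Finset.sum_le_sum fun a _ => Set.ncard_image_le
      have hsum : (∑ a : Fin d × Bool,
            ({ω : Fin n → Fin d × Bool | ∃ y ∈ rangeW (x + step a) ω, y ∈ Q}.ncard : ℝ)) /
              (2 * d) ^ n ≤ ∑ a : Fin d × Bool, f n (x + step a) := by
        rw [Finset.sum_div]
        exact Finset.sum_le_sum fun a _ => ih (x + step a)
      calc prW d (n + 1) {ω | ∃ y ∈ rangeW x ω, y ∈ Q}
          ≤ (∑ a : Fin d × Bool,
            ({ω : Fin n → Fin d × Bool | ∃ y ∈ rangeW (x + step a) ω, y ∈ Q}.ncard : ℝ)) /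
              (2 * d) ^ (n + 1) := by
            unfold prW
            gcongr
        _ = (∑ a : Fin d × Bool,
            ({ω : Fin n → Fin d × Bool | ∃ y ∈ rangeW (x + step a) ω, y ∈ Q}.ncard : ℝ)) /
              (2 * d) ^ n / (2 * d) := by rw [pow_succ, div_div]
        _ ≤ _ := by gcongr

/-- The expected number of visits to `x` before time `T` of the walk on `ℤ²` started at `0`. -/
noncomputable def planeGreen (T : ℕ) (x : Fin 2 → ℤ) : ℝ :=
  ∑ t ∈ Finset.range T, planeKernel t x

lemma planeGreen_nonneg (T : ℕ) (x : Fin 2 → ℤ) : 0 ≤ planeGreen T x :=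
  Finset.sum_nonneg fun _ _ => planeKernel_nonneg _ _

lemma planeGreen_mono (x : Fin 2 → ℤ) : Monotone fun T => planeGreen T x := by
  intro S T h
  exact Finset.sum_le_sum_of_subset_of_nonneg (Finset.range_subset_range.2 h)
    fun _ _ _ => planeKernel_nonneg _ _

lemma sum_planeGreen_le (T : ℕ) (x : Fin 2 → ℤ) :
    (∑ a : Fin 2 × Bool, planeGreen T (x - step a)) / 4 ≤ planeGreen (T + 1) x := by
  unfold planeGreen
  rw [Finset.sum_comm, Finset.sum_div, Finset.sum_range_succ']
  simp only [planeKernel_succ]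
  linarith [planeKernel_nonneg 0 x]

lemma planeGreen_two_mul (M : ℕ) (x : Fin 2 → ℤ) : planeGreen (2 * M) x =
    ∑ m ∈ Finset.range M, (planeKernel (2 * m) x + planeKernel (2 * m + 1) x) := by
  induction M with
  | zero => simp [planeGreen]
  | succ M ih =>
    rw [Finset.sum_range_succ, ← ih, mul_add_one]
    unfold planeGreen
    rw [Finset.sum_range_succ, Finset.sum_range_succ, add_assoc]

lemma log_div_le_sum_Ico_one_div (a b : ℕ) (ha : 1 ≤ a) (hab : a ≤ b) :
    log (b / a) ≤ ∑ m ∈ Finset.Ico a b, 1 / (m : ℝ) := by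
  induction b, hab using Nat.le_induction with
  | base =>
    have : (a : ℝ) ≠ 0 := by positivity
    simp [div_self this]
  | succ b hb ih =>
    rw [Finset.sum_Ico_succ_top hb]
    have hb0 : (0 : ℝ) < b := by exact_mod_cast (ha.trans hb)
    have ha0 : (0 : ℝ) < a := by exact_mod_cast ha
    have : ((b + 1 : ℕ) : ℝ) / a = (b / a) * (1 + 1 / b) := by
      push_cast; field_simp
    rw [this, log_mul (by positivity) (by positivity)]
    have := log_le_sub_one_of_pos (show (0 : ℝ) < 1 + 1 / b by positivity)
    linarith

lemma log_le_planeGreen (n k : ℕ) (hn : 1 ≤ n) (hk : k ^ 4 ≤ n) (x : Fin 2 → ℤ)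
    (h0 : |x 0| ≤ k) (h1 : |x 1| ≤ k) : log n / 32 ≤ planeGreen (2 * (3 * n)) x := by
  have hkn : (2 * k ^ 2 + 1) ^ 2 ≤ 9 * n := by
    have : k ^ 2 ≤ k ^ 4 ∨ k = 0 := by
      rcases Nat.eq_zero_or_pos k with h | h
      · exact Or.inr h
      · exact Or.inl (Nat.pow_le_pow_right h (by norm_num))
    rcases this with h | h
    · nlinarith
    · subst h; omega
  have hle : 2 * k ^ 2 + 1 ≤ 3 * n := by nlinarith
  have hn0 : (0 : ℝ) < n := by exact_mod_cast hn
  rw [planeGreen_two_mul]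
  have hlog : log n / 2 ≤ log (((3 * n : ℕ) : ℝ) / ((2 * k ^ 2 + 1 : ℕ) : ℝ)) := by
    have e : log n / 2 = log √n := by rw [log_sqrt hn0.le]
    rw [e]
    apply log_le_log (by positivity)
    rw [le_div_iff₀ (by positivity)]
    have h2 : ((2 * k ^ 2 + 1 : ℕ) : ℝ) ≤ 3 * √n := by
      apply le_of_sq_le_sq _ (by positivity)
      rw [mul_pow, sq_sqrt hn0.le]
      norm_num
      exact_mod_cast hkn
    calc √(n : ℝ) * ((2 * k ^ 2 + 1 : ℕ) : ℝ) ≤ √n * (3 * √n) := by gcongr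
      _ = 3 * (√n * √n) := by ring
      _ = _ := by rw [mul_self_sqrt hn0.le]; push_cast; ring
  have hsum := log_div_le_sum_Ico_one_div (2 * k ^ 2 + 1) (3 * n) (by omega) hle
  calc log n / 32 ≤ (∑ m ∈ Finset.Ico (2 * k ^ 2 + 1) (3 * n), 1 / (m : ℝ)) / 16 := by linarith
    _ ≤ ∑ m ∈ Finset.Ico (2 * k ^ 2 + 1) (3 * n),
          (planeKernel (2 * m) x + planeKernel (2 * m + 1) x) := by
        rw [Finset.sum_div]
        apply Finset.sum_le_sum
        intro m hm
        rw [Finset.mem_Ico] at hm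
        rw [div_div, mul_comm (m : ℝ)]
        exact le_planeKernel_add m k (by omega) (by omega) x h0 h1
    _ ≤ _ := by
        apply Finset.sum_le_sum_of_subset_of_nonneg
        · intro m hm
          rw [Finset.mem_Ico] at hm
          exact Finset.mem_range.2 hm.2
        · intro m _ _
          exact add_nonneg (planeKernel_nonneg _ _) (planeKernel_nonneg _ _)

lemma exp_neg_div_le (s r : ℝ) (hs : 0 < s) (hr : 0 < r) :
    exp (-s / (4 * r)) / r ≤ 8 / s * exp (-s / (8 * r)) := by
  have h1 : s / (8 * r) ≤ exp (s / (8 * r)) := by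
    linarith [add_one_le_exp (s / (8 * r))]
  have h2 : exp (-s / (4 * r)) = exp (-s / (8 * r)) * exp (-s / (8 * r)) := by
    rw [← exp_add]; congr 1; field_simp; norm_num
  have h3 : s / (8 * r) * exp (-s / (8 * r)) ≤ 1 := by
    calc s / (8 * r) * exp (-s / (8 * r)) ≤ exp (s / (8 * r)) * exp (-s / (8 * r)) := by gcongr
      _ = 1 := by rw [← exp_add, neg_div, add_neg_cancel, exp_zero]
  calc exp (-s / (4 * r)) / r
      = 8 / s * (s / (8 * r) * exp (-s / (8 * r))) * exp (-s / (8 * r)) := by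
        rw [h2]; field_simp
    _ ≤ 8 / s * 1 * exp (-s / (8 * r)) := by gcongr
    _ = _ := by ring

lemma planeGreen_le (n : ℕ) (hn : 2 ≤ n) (x : Fin 2 → ℤ) (s : ℝ)
    (hxs : (x 0 : ℝ) ^ 2 + (x 1 : ℝ) ^ 2 = s) (hs : 25 * n ≤ s) :
    planeGreen (2 * (4 * n)) x ≤ 3 * exp (-s / (64 * n)) := by
  have hn2 : (2 : ℝ) ≤ n := by exact_mod_cast hn
  have hs0 : 0 < s := by linarith
  have term : ∀ m ∈ Finset.range (4 * n), planeKernel (2 * m) x + planeKernel (2 * m + 1) x ≤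
      16 / s * exp (-s / (64 * n)) := by
    intro m hm
    have hm' : (2 * (m : ℝ) + 1) ≤ 8 * n := by
      have : 2 * m + 1 ≤ 8 * n := by have := Finset.mem_range.1 hm; omega
      exact_mod_cast this
    have hpos : (0 : ℝ) < 2 * m + 1 := by positivity
    have h1 := planeKernel_even_le m x
    have h2 := planeKernel_odd_le m x (by rw [hxs]; linarith)
    rw [hxs] at h1 h2
    have h3 := exp_neg_div_le s (2 * m + 1) hs0 hpos
    have h4 : exp (-s / (2 * (2 * m + 1))) / (2 * m + 1) ≤
        exp (-s / (4 * (2 * m + 1))) / (2 * m + 1) := by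
      gcongr ?_ / _
      rw [exp_le_exp, div_le_div_iff₀ (by positivity) (by positivity)]
      nlinarith
    have h5 : 8 / s * exp (-s / (8 * (2 * m + 1))) ≤ 8 / s * exp (-s / (64 * n)) := by
      gcongr ?_ * ?_
      rw [exp_le_exp, div_le_div_iff₀ (by positivity) (by positivity)]
      nlinarith
    calc _ ≤ 2 * (8 / s * exp (-s / (64 * n))) := by linarith
      _ = _ := by ring
  rw [planeGreen_two_mul]
  refine (Finset.sum_le_card_nsmul _ _ _ term).trans ?_
  rw [Finset.card_range, nsmul_eq_mul, ← mul_assoc]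
  gcongr
  push_cast
  rw [mul_div_assoc', div_le_iff₀ hs0]
  linarith

/-- For `k ≤ n^{1/4}` and `‖z‖ ≥ 5√n`,
`P[R(n) ∩ Q(z,k) ≠ ∅] ≤ (C/log n) · exp(-c‖z‖²/n)`. -/
theorem prob_range_hits_far_square :
    ∃ c C : ℝ, 0 < c ∧ 0 < C ∧ ∀ n k : ℕ, 2 ≤ n → (k : ℝ) ≤ (n : ℝ) ^ ((1 : ℝ) / 4) →
      ∀ z : Fin 2 → ℤ, 5 * Real.sqrt n ≤ eNorm z →
      prW 2 n {ω | ∃ x ∈ rangeW (0 : Fin 2 → ℤ) ω, x ∈ square z k} ≤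
        C / Real.log n * Real.exp (-c * (eNorm z) ^ 2 / n) := by
  refine ⟨1 / 64, 96, by norm_num, by norm_num, ?_⟩
  intro n k hn hk z hz
  have hn2 : (2 : ℝ) ≤ n := by exact_mod_cast hn
  have hn0 : (0 : ℝ) < n := by linarith
  have hlog : 0 < log n := log_pos (by linarith)
  have hk4 : k ^ 4 ≤ n := by
    have h : (k : ℝ) ^ 4 ≤ ((n : ℝ) ^ ((1 : ℝ) / 4)) ^ 4 := by gcongr
    rw [← rpow_natCast ((n : ℝ) ^ ((1 : ℝ) / 4)), ← rpow_mul hn0.le] at h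
    norm_num at h
    exact_mod_cast h
  have hnorm : (z 0 : ℝ) ^ 2 + (z 1 : ℝ) ^ 2 = eNorm z ^ 2 := by
    unfold eNorm
    rw [sq_sqrt (by positivity), Fin.sum_univ_two]
  have hfar : 25 * n ≤ eNorm z ^ 2 := by
    calc 25 * (n : ℝ) = (5 * √n) ^ 2 := by rw [mul_pow, sq_sqrt hn0.le]; norm_num
      _ ≤ _ := by gcongr
  have hhit := prW_hit_le_of_superharmonic (square z k)
    (fun t x => planeGreen (t + 2 * (3 * n)) (z - x) / (log n / 32))
    (fun t x => div_nonneg (planeGreen_nonneg _ _) (by positivity))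
    (by
      intro t x hx
      rw [le_div_iff₀ (by positivity), one_mul]
      refine (log_le_planeGreen n k (by omega) hk4 (z - x) ?_ ?_).trans
        (planeGreen_mono _ (Nat.le_add_left _ _))
      · rw [Pi.sub_apply, abs_sub_comm]; exact hx 0
      · rw [Pi.sub_apply, abs_sub_comm]; exact hx 1)
    (by
      intro t x
      rw [← Finset.sum_div, div_right_comm]
      gcongr
      have h := sum_planeGreen_le (t + 2 * (3 * n)) (z - x)
      simp only [sub_sub] at h
      rw [show t + 1 + 2 * (3 * n) = t + 2 * (3 * n) + 1 by ring]
      norm_num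
      exact h)
    n 0
  refine hhit.trans ?_
  rw [sub_zero, div_le_iff₀ (by positivity)]
  have hmono : planeGreen (n + 2 * (3 * n)) z ≤ planeGreen (2 * (4 * n)) z :=
    planeGreen_mono z (by omega)
  refine hmono.trans ((planeGreen_le n hn z _ hnorm hfar).trans (le_of_eq ?_))
  rw [show -(1 / 64) * eNorm z ^ 2 / (n : ℝ) = -eNorm z ^ 2 / (64 * n) by field_simp]
  field_simp
  norm_num
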